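/- Let ϑ: ℝ → ℝ satisfy (P1) 0 ≤ ϑ(w) ≤ 1 on [0,1], (P2) ϑ(w) + ϑ(1−w) = 1, (P3) ϑ monotonically decreasing on [0,1], (P4) ϑ(w) = 1 for 0 ≤ w ≤ 1/3, (P5) ϑ(w) ≥ 2 − 3w on [1/3, 1/2] and ϑ(w) ≤ 2 − 3w on [1/2, 2/3], extended by ϑ(w) = ϑ(−w) for −1 ≤ w ≤ 0 and ϑ(w) = 0 for |w| > 1, and let φ be the Meyer scaling function φ(x) = ∫_{−1}^{1} √(ϑ(w)) e^{2πiwx} dw. Then for every integer s ≥ 1, M_s := esssup_{w∈[0,1]} Σ_{l∈ℤ} (w+l)^{2s} |φ̂(w+l)|² ≤ ( (1/3)^{2s} + (2/3)^{2s} ) / 2. -/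

import Mathlib

open MeasureTheory FourierTransform Filter Real Set

/-- Properties (P1)–(P5) of the profile function `ϑ` of a Meyer scaling function,
together with its extension (even on `[-1,0]`, vanishing for `|w| > 1`). -/
def MeyerTheta (ϑ : ℝ → ℝ) : Prop :=
  (∀ w ∈ Set.Icc (0:ℝ) 1, 0 ≤ ϑ w ∧ ϑ w ≤ 1) ∧
  (∀ w ∈ Set.Icc (0:ℝ) 1, ϑ w + ϑ (1 - w) = 1) ∧
  AntitoneOn ϑ (Set.Icc (0:ℝ) 1) ∧
  (∀ w ∈ Set.Icc (0:ℝ) (1/3), ϑ w = 1) ∧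
  (∀ w ∈ Set.Icc (1/3 : ℝ) (1/2), 2 - 3 * w ≤ ϑ w) ∧
  (∀ w ∈ Set.Icc (1/2 : ℝ) (2/3), ϑ w ≤ 2 - 3 * w) ∧
  (∀ w ∈ Set.Icc (-1 : ℝ) 0, ϑ w = ϑ (-w)) ∧
  (∀ w : ℝ, 1 < |w| → ϑ w = 0)

/-- A convexity estimate: the worst case of the two-term Meyer sum on `[1/3, 1/2]`. -/
lemma meyer_linear_profile_bound (n : ℕ) {w : ℝ} (h₁ : 1 / 3 ≤ w) (h₂ : w ≤ 1 / 2) :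
    (2 - 3 * w) * w ^ n + (3 * w - 1) * (1 - w) ^ n ≤ ((1 / 3 : ℝ) ^ n + (2 / 3 : ℝ) ^ n) / 2 := by
  have hconv := convexOn_pow (𝕜 := ℝ) n
  have ha : (1 / 3 : ℝ) ∈ Ici (0 : ℝ) := by norm_num
  have hb : (2 / 3 : ℝ) ∈ Ici (0 : ℝ) := by norm_num
  have hp : 0 ≤ 2 - 3 * w := by linarith
  have hq : 0 ≤ 3 * w - 1 := by linarith
  have hw := hconv.2 ha hb hp hq (by ring)
  have hw' := hconv.2 ha hb hq hp (by ring)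
  simp only [smul_eq_mul] at hw hw'
  rw [show (2 - 3 * w) * (1 / 3) + (3 * w - 1) * (2 / 3) = w by ring] at hw
  rw [show (3 * w - 1) * (1 / 3) + (2 - 3 * w) * (2 / 3) = 1 - w by ring] at hw'
  have hab : (1 / 3 : ℝ) ^ n ≤ (2 / 3 : ℝ) ^ n := by gcongr; norm_num
  nlinarith [mul_le_mul_of_nonneg_left hw hp, mul_le_mul_of_nonneg_left hw' hq,
    mul_nonneg (sq_nonneg (2 * w - 1)) (sub_nonneg.2 hab)]

lemma MeyerTheta.two_term_le_of_le_half {ϑ : ℝ → ℝ} (hϑ : MeyerTheta ϑ) (n : ℕ) {w : ℝ}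
    (h₀ : 0 ≤ w) (h₂ : w ≤ 1 / 2) :
    w ^ n * ϑ w + (1 - w) ^ n * ϑ (1 - w) ≤ ((1 / 3 : ℝ) ^ n + (2 / 3 : ℝ) ^ n) / 2 := by
  obtain ⟨-, hsum, -, hone, hlower, -⟩ := hϑ
  have hϑ' : ϑ (1 - w) = 1 - ϑ w := by linarith [hsum w ⟨h₀, by linarith⟩]
  rw [hϑ']
  rcases le_total w (1 / 3) with h | h
  · rw [hone w ⟨h₀, h⟩]
    have hwa : w ^ n ≤ (1 / 3 : ℝ) ^ n := by gcongr
    have hab : (1 / 3 : ℝ) ^ n ≤ (2 / 3 : ℝ) ^ n := by gcongr; norm_num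
    linarith
  · have hle : w ^ n ≤ (1 - w) ^ n := by gcongr; linarith
    nlinarith [meyer_linear_profile_bound n h h₂,
      mul_nonneg (sub_nonneg.2 (hlower w ⟨h, h₂⟩)) (sub_nonneg.2 hle)]

lemma MeyerTheta.two_term_le {ϑ : ℝ → ℝ} (hϑ : MeyerTheta ϑ) (n : ℕ) {w : ℝ}
    (h₀ : 0 ≤ w) (h₁ : w ≤ 1) :
    w ^ n * ϑ w + (1 - w) ^ n * ϑ (1 - w) ≤ ((1 / 3 : ℝ) ^ n + (2 / 3 : ℝ) ^ n) / 2 := by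
  rcases le_total w (1 / 2) with h | h
  · exact hϑ.two_term_le_of_le_half n h₀ h
  · have := hϑ.two_term_le_of_le_half n (w := 1 - w) (by linarith) (by linarith)
    rw [sub_sub_cancel] at this
    linarith

lemma MeyerTheta.tsum_eq {ϑ : ℝ → ℝ} (hϑ : MeyerTheta ϑ) (s : ℕ) {w : ℝ}
    (h₀ : 0 < w) (h₁ : w < 1) :
    ∑' l : ℤ, (w + (l : ℝ)) ^ (2 * s) * √(ϑ (w + l)) ^ 2 =
      w ^ (2 * s) * ϑ w + (1 - w) ^ (2 * s) * ϑ (1 - w) := by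
  obtain ⟨hbd, -, -, -, -, -, heven, hzero⟩ := hϑ
  rw [tsum_eq_sum (s := ({0, -1} : Finset ℤ))]
  · rw [Finset.sum_pair (by norm_num)]
    have hneg : ϑ (w + -1) = ϑ (1 - w) := by
      rw [heven _ ⟨by linarith, by linarith⟩]
      congr 1
      ring
    have hpow : (w + -1) ^ (2 * s) = (1 - w) ^ (2 * s) := by
      rw [← (even_two_mul s).neg_pow]
      congr 1
      ring
    push_cast
    rw [add_zero, hneg, hpow, Real.sq_sqrt (hbd w ⟨h₀.le, h₁.le⟩).1,
      Real.sq_sqrt (hbd (1 - w) ⟨by linarith, by linarith⟩).1]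
  · intro l hl
    simp only [Finset.mem_insert, Finset.mem_singleton, not_or] at hl
    have habs : 1 < |w + (l : ℝ)| := by
      rcases (by lia : 1 ≤ l ∨ l ≤ -2) with h | h
      · have : (1 : ℝ) ≤ l := by exact_mod_cast h
        exact lt_abs.2 (Or.inl (by linarith))
      · have : (l : ℝ) ≤ -2 := by exact_mod_cast h
        exact lt_abs.2 (Or.inr (by linarith))
    simp [hzero _ habs]

theorem stmt17 (ϑ : ℝ → ℝ) (hϑ : MeyerTheta ϑ)
    (φ : ℝ → ℂ)
    (hφ : ∀ x : ℝ, φ x = ∫ w in (-1 : ℝ)..1,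
      (Real.sqrt (ϑ w) : ℂ) * Complex.exp (2 * Real.pi * Complex.I * w * x))
    (hFourier : ∀ w : ℝ, 𝓕 φ w = (Real.sqrt (ϑ w) : ℂ))
    (hortho : ∀ᵐ w : ℝ, ∑' l : ℤ, ‖𝓕 φ (w + l)‖ ^ 2 = 1)
    (s : ℕ) (hs : 1 ≤ s) :
    essSup (fun w : ℝ => ENNReal.ofReal
        (∑' l : ℤ, (w + (l : ℝ)) ^ (2 * s) * ‖𝓕 φ (w + l)‖ ^ 2))
      (volume.restrict (Icc (0:ℝ) 1)) ≤
      ENNReal.ofReal (((1/3 : ℝ) ^ (2 * s) + (2/3 : ℝ) ^ (2 * s)) / 2) := by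
  have hne : ∀ a : ℝ, ∀ᵐ w ∂(volume.restrict (Icc (0 : ℝ) 1)), w ≠ a :=
    fun a => ae_restrict_of_ae (Measure.ae_ne volume a)
  refine essSup_le_of_ae_le _ ?_
  filter_upwards [ae_restrict_mem measurableSet_Icc, hne 0, hne 1] with w hw hw₀ hw₁
  refine ENNReal.ofReal_le_ofReal ?_
  simp only [hFourier, Complex.norm_real, Real.norm_eq_abs, sq_abs]
  rw [hϑ.tsum_eq s (lt_of_le_of_ne hw.1 hw₀.symm) (lt_of_le_of_ne hw.2 hw₁)]
  exact hϑ.two_term_le (2 * s) hw.1 hw.2
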